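/- arXiv:1606.08055 — 5 statements merged into one kernel-verified Lean document; each statement's English description precedes it below -/
import Mathlib

section
/- The Wronskians satisfy 𝒢_1(x) = 1 and, for every n ≥ 1, the polynomial identity 𝒢_{n+1}(x) = P_n(x)[P_n(x) − 2 d_{n+1} x P_{n−1}(x)] + d_{n+1}(x² + 1) 𝒢_n(x). -/
open Polynomial

/-- The polynomials `P_n` from the special `R_{II}` type recurrence. -/
noncomputable def Ppoly (c d : ℕ → ℝ) : ℕ → Polynomial ℝ
  | 0 => 1
  | 1 => X - C (c 1)
  | (n + 2) => (X - C (c (n + 2))) * Ppoly c d (n + 1)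
      - C (d (n + 2)) * (X ^ 2 + 1) * Ppoly c d n

/-- The Wronskian `𝒢_n = P_n' P_{n-1} - P_{n-1}' P_n` (meaningful for `n ≥ 1`). -/
noncomputable def Gw (c d : ℕ → ℝ) (n : ℕ) : Polynomial ℝ :=
  derivative (Ppoly c d n) * Ppoly c d (n - 1)
    - derivative (Ppoly c d (n - 1)) * Ppoly c d n

theorem stmt3 (c ℓ d : ℕ → ℝ)
    (hℓ1 : ℓ 1 = 0)
    (hℓ : ∀ n, 2 ≤ n → 0 < ℓ n ∧ ℓ n < 1)
    (hd : ∀ n, 1 ≤ n → d (n + 1) = (1 - ℓ n) * ℓ (n + 1)) :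
    Gw c d 1 = 1 ∧
    ∀ n, 1 ≤ n →
      Gw c d (n + 1) =
        Ppoly c d n * (Ppoly c d n - C (2 * d (n + 1)) * X * Ppoly c d (n - 1))
          + C (d (n + 1)) * (X ^ 2 + 1) * Gw c d n := by
  refine ⟨by simp [Gw, Ppoly], fun n hn => ?_⟩
  obtain ⟨m, rfl⟩ := Nat.exists_eq_add_of_le' hn
  simp only [Gw, Ppoly, Nat.add_sub_cancel, derivative_sub, derivative_mul, derivative_add,
    derivative_X, derivative_C, derivative_X_pow, derivative_one, C_mul]
  simp only [Nat.cast_ofNat, map_ofNat]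
  ring
end

section
/- For every n ≥ 1, the polynomial P_n has exactly n zeros, all real and simple; moreover, labeling the zeros of P_n in decreasing order x_1^{(n)} > x_2^{(n)} > ⋯ > x_n^{(n)}, the zeros of consecutive polynomials interlace: x_{j+1}^{(n+1)} < x_j^{(n)} < x_j^{(n+1)} for all 1 ≤ j ≤ n and all n ≥ 1. -/
open Polynomial

theorem Ppoly_add_two (c d : ℕ → ℝ) (n : ℕ) :
    Ppoly c d (n + 2) = (X - C (c (n + 2))) * Ppoly c d (n + 1)
      - C (d (n + 2)) * (X ^ 2 + 1) * Ppoly c d n := by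
  rw [Ppoly]

theorem natDegree_Ppoly_le (c d : ℕ → ℝ) (n : ℕ) : (Ppoly c d n).natDegree ≤ n := by
  induction n using Nat.twoStepInduction with
  | zero => simp [Ppoly]
  | one => simp [Ppoly]
  | more n h0 h1 =>
    have hlin : (X - C (c (n + 2)) : ℝ[X]).natDegree ≤ 1 := by compute_degree
    have hquad : (C (d (n + 2)) * (X ^ 2 + 1 : ℝ[X])).natDegree ≤ 2 := by compute_degree
    rw [Ppoly_add_two]
    refine (natDegree_sub_le _ _).trans (max_le ?_ ?_)
    · exact (natDegree_mul_le_of_le hlin h1).trans (by omega)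
    · exact (natDegree_mul_le_of_le hquad h0).trans (by omega)

theorem coeff_Ppoly_add_two (c d : ℕ → ℝ) (n : ℕ) :
    (Ppoly c d (n + 2)).coeff (n + 2)
      = (Ppoly c d (n + 1)).coeff (n + 1) - d (n + 2) * (Ppoly c d n).coeff n := by
  have h1 : (Ppoly c d (n + 1)).coeff (n + 2) = 0 :=
    coeff_eq_zero_of_natDegree_lt ((natDegree_Ppoly_le c d (n + 1)).trans_lt (by omega))
  have h0 : (Ppoly c d n).coeff (n + 2) = 0 :=
    coeff_eq_zero_of_natDegree_lt ((natDegree_Ppoly_le c d n).trans_lt (by omega))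
  rw [Ppoly_add_two, coeff_sub, sub_mul, coeff_sub, coeff_C_mul, h1, mul_assoc, coeff_C_mul,
    add_mul, coeff_add, one_mul, h0, coeff_X_pow_mul, show n + 2 = (n + 1) + 1 from rfl,
    coeff_X_mul]
  ring

/-- The coefficient of `X ^ n` in `P_n` is `∏ k ∈ [1, n], (1 - ℓ k)`. -/
theorem coeff_Ppoly_self {c ℓ d : ℕ → ℝ} (hℓ1 : ℓ 1 = 0)
    (hd : ∀ n, 1 ≤ n → d (n + 1) = (1 - ℓ n) * ℓ (n + 1)) (n : ℕ) :
    (Ppoly c d n).coeff n = ∏ k ∈ Finset.range n, (1 - ℓ (k + 1)) := by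
  induction n using Nat.twoStepInduction with
  | zero => simp [Ppoly]
  | one => simp [Ppoly, hℓ1]
  | more n h0 h1 =>
    rw [coeff_Ppoly_add_two, h0, h1, hd (n + 1) (by omega), Finset.prod_range_succ _ (n + 1),
      Finset.prod_range_succ]
    ring

theorem coeff_Ppoly_self_pos {c ℓ d : ℕ → ℝ} (hℓ1 : ℓ 1 = 0)
    (hℓ : ∀ n, 2 ≤ n → 0 < ℓ n ∧ ℓ n < 1)
    (hd : ∀ n, 1 ≤ n → d (n + 1) = (1 - ℓ n) * ℓ (n + 1)) (n : ℕ) :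
    0 < (Ppoly c d n).coeff n := by
  rw [coeff_Ppoly_self hℓ1 hd]
  refine Finset.prod_pos fun k _ => ?_
  rcases k with _ | k
  · simp [hℓ1]
  · linarith [(hℓ (k + 1 + 1) (by omega)).2]

theorem chain_sequence_pos {ℓ d : ℕ → ℝ} (hℓ1 : ℓ 1 = 0)
    (hℓ : ∀ n, 2 ≤ n → 0 < ℓ n ∧ ℓ n < 1)
    (hd : ∀ n, 1 ≤ n → d (n + 1) = (1 - ℓ n) * ℓ (n + 1)) (n : ℕ) : 0 < d (n + 2) := by
  rw [hd (n + 1) (by omega)]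
  refine mul_pos ?_ (hℓ _ (by omega)).1
  rcases n with _ | n
  · simp [hℓ1]
  · linarith [(hℓ (n + 1 + 1) (by omega)).2]

theorem lt_of_succ_lt {x : ℕ → ℝ} {n : ℕ} (hx : ∀ i, i + 1 < n → x (i + 1) < x i) {i j : ℕ}
    (hij : i < j) (hj : j < n) : x j < x i := by
  induction j, hij using Nat.le_induction with
  | base => exact hx i hj
  | succ j _ ih => exact (hx j hj).trans (ih (by omega))

theorem nodup_map_range_of_lt {x : ℕ → ℝ} {n : ℕ} (hx : ∀ i j, i < j → j < n → x j < x i) :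
    ((Multiset.range n).map x).Nodup := by
  refine (Multiset.nodup_range n).map_on fun i hi j hj hij => ?_
  rw [Multiset.mem_range] at hi hj
  rcases lt_trichotomy i j with h | h | h
  · exact absurd hij (hx i j h hj).ne'
  · exact h
  · exact absurd hij (hx j i h hi).ne

/-- The sign of `∏ (t - x i)` is determined by the number of `x i` to the right of `t`. -/
theorem neg_one_pow_mul_prod_sub_pos {x : ℕ → ℝ} {t : ℝ} {k n : ℕ} (hk : k ≤ n)
    (hlt : ∀ i, i < k → t < x i) (hgt : ∀ i, k ≤ i → i < n → x i < t) :
    0 < (-1) ^ k * ∏ i ∈ Finset.range n, (t - x i) := by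
  rw [← Finset.prod_range_mul_prod_Ico _ hk, ← mul_assoc]
  refine mul_pos ?_ (Finset.prod_pos fun i hi => ?_)
  · have : (-1 : ℝ) ^ k = ∏ _i ∈ Finset.range k, (-1 : ℝ) := by simp
    rw [this, ← Finset.prod_mul_distrib]
    exact Finset.prod_pos fun i hi => by linarith [hlt i (Finset.mem_range.1 hi)]
  · rw [Finset.mem_Ico] at hi
    linarith [hgt i hi.1 hi.2]

theorem exists_root_between {Q : ℝ[X]} {a b : ℝ} (hab : a < b) {k : ℕ}
    (hb : 0 < (-1) ^ k * Q.eval b) (ha : 0 < (-1) ^ (k + 1) * Q.eval a) :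
    ∃ y, a < y ∧ y < b ∧ Q.IsRoot y := by
  have hcont : ContinuousOn (fun t => (-1) ^ k * Q.eval t) (Set.Icc a b) := by fun_prop
  have ha' : (-1) ^ k * Q.eval a < 0 := by
    rw [pow_succ] at ha
    linarith
  obtain ⟨y, hy, hy0⟩ := intermediate_value_Ioo hab.le hcont ⟨ha', hb⟩
  exact ⟨y, hy.1, hy.2, by simpa using hy0⟩

/-- Roots of a polynomial alternating in sign at `natDegree + 1` decreasing points. -/
theorem exists_roots_between {Q : ℝ[X]} {n : ℕ} (hQ : Q.natDegree ≤ n) {z : ℕ → ℝ}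
    (hz : ∀ k, k < n → z (k + 1) < z k) (hsign : ∀ k, k ≤ n → 0 < (-1) ^ k * Q.eval (z k)) :
    ∃ y : ℕ → ℝ, (∀ k, k < n → z (k + 1) < y k ∧ y k < z k) ∧
      Q.roots = (Multiset.range n).map y := by
  have hex : ∀ k, ∃ y, k < n → z (k + 1) < y ∧ y < z k ∧ Q.IsRoot y := fun k => by
    by_cases hk : k < n
    · obtain ⟨y, hy⟩ := exists_root_between (hz k hk) (hsign k hk.le) (hsign (k + 1) hk)
      exact ⟨y, fun _ => hy⟩
    · exact ⟨0, fun h => absurd h hk⟩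
  choose y hy using hex
  refine ⟨y, fun k hk => ⟨(hy k hk).1, (hy k hk).2.1⟩, ?_⟩
  have hQ0 : Q ≠ 0 := by
    rintro rfl
    simpa using hsign 0 (Nat.zero_le n)
  have hanti : ∀ i j, i < j → j < n → y j < y i := fun i j =>
    lt_of_succ_lt fun i hi => (hy (i + 1) hi).2.1.trans (hy i (by omega)).1
  have hnodup := nodup_map_range_of_lt hanti
  refine (Multiset.eq_of_le_of_card_le ?_ ?_).symm
  · refine (Multiset.le_iff_subset hnodup).2 fun t ht => ?_
    obtain ⟨k, hk, rfl⟩ := Multiset.mem_map.1 ht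
    exact (mem_roots hQ0).2 (hy k (Multiset.mem_range.1 hk)).2.2
  · simpa using (card_roots' Q).trans hQ

theorem eval_eq_coeff_mul_prod {Q : ℝ[X]} {n : ℕ} (hQ : Q.natDegree = n) {x : ℕ → ℝ}
    (hx : Q.roots = (Multiset.range n).map x) (t : ℝ) :
    Q.eval t = Q.coeff n * ∏ i ∈ Finset.range n, (t - x i) := by
  have hcard : Q.roots.card = Q.natDegree := by simp [hx, hQ]
  have h := congrArg (eval t) (C_leadingCoeff_mul_prod_multiset_X_sub_C hcard)
  rw [← h, eval_mul, eval_C, leadingCoeff, hQ, hx, eval_multiset_prod]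
  simp [Finset.prod, Finset.range]

theorem exists_gt_eval_pos {Q : ℝ[X]} (hdeg : 0 < Q.natDegree) (hlead : 0 < Q.leadingCoeff)
    (b : ℝ) : ∃ t, b < t ∧ 0 < Q.eval t := by
  have h := Q.tendsto_atTop_of_leadingCoeff_nonneg (natDegree_pos_iff_degree_pos.1 hdeg) hlead.le
  exact ((Filter.eventually_gt_atTop b).and (h.eventually_gt_atTop 0)).exists

theorem exists_lt_neg_one_pow_mul_eval_pos {Q : ℝ[X]} (hdeg : 0 < Q.natDegree)
    (hlead : 0 < Q.leadingCoeff) (b : ℝ) :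
    ∃ t, t < b ∧ 0 < (-1) ^ Q.natDegree * Q.eval t := by
  let R : ℝ[X] := C ((-1) ^ Q.natDegree) * Q.comp (-X)
  have hu : (-1 : ℝ) ^ Q.natDegree ≠ 0 := by simp
  have hRdeg : R.natDegree = Q.natDegree := by
    rw [natDegree_C_mul hu, natDegree_comp, natDegree_neg, natDegree_X, mul_one]
  have hRlead : R.leadingCoeff = Q.leadingCoeff := by
    have : (-X : ℝ[X]).natDegree ≠ 0 := by simp
    simp only [R, leadingCoeff_mul, leadingCoeff_C, leadingCoeff_comp this, leadingCoeff_neg,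
      leadingCoeff_X]
    rw [mul_left_comm, ← mul_pow]
    simp
  obtain ⟨t, ht, htp⟩ := exists_gt_eval_pos (hRdeg ▸ hdeg) (hRlead ▸ hlead) (-b)
  exact ⟨-t, by linarith, by simpa [R] using htp⟩

/-- `x 0 > ⋯ > x (n - 1)` are the roots of `P_n`, and `P_{n+1}` alternates in sign at them. -/
structure IsZeroList (c d : ℕ → ℝ) (n : ℕ) (x : ℕ → ℝ) : Prop where
  lt : ∀ i j, i < j → j < n → x j < x i
  roots_eq : (Ppoly c d n).roots = (Multiset.range n).map x
  sign : ∀ i, i < n → 0 < (-1) ^ (i + 1) * (Ppoly c d (n + 1)).eval (x i)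

theorem isZeroList_zero (c d x : ℕ → ℝ) : IsZeroList c d 0 x where
  lt _ _ _ h := absurd h (by omega)
  roots_eq := by simp [Ppoly]
  sign _ h := absurd h (by omega)

theorem IsZeroList.exists_succ {c d : ℕ → ℝ} {n : ℕ} {x : ℕ → ℝ} (hx : IsZeroList c d n x)
    (hpos : ∀ m, 0 < (Ppoly c d m).coeff m) (hdpos : 0 < d (n + 2)) :
    ∃ y, IsZeroList c d (n + 1) y ∧ ∀ i, i < n → y (i + 1) < x i ∧ x i < y i := by
  have hdeg (m : ℕ) : (Ppoly c d m).natDegree = m :=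
    natDegree_eq_of_le_of_coeff_ne_zero (natDegree_Ppoly_le c d m) (hpos m).ne'
  have hlead : 0 < (Ppoly c d (n + 1)).leadingCoeff := by
    rw [leadingCoeff, hdeg]
    exact hpos _
  have hdeg' : 0 < (Ppoly c d (n + 1)).natDegree := by rw [hdeg]; omega
  obtain ⟨M, hM, hMpos⟩ := exists_gt_eval_pos hdeg' hlead (x 0)
  obtain ⟨m, hm, hmpos⟩ := exists_lt_neg_one_pow_mul_eval_pos hdeg' hlead (min M (x (n - 1)))
  rw [hdeg] at hmpos
  let z : ℕ → ℝ := fun k => if k = 0 then M else if k ≤ n then x (k - 1) else m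
  have hz0 : z 0 = M := by simp [z]
  have hzx (i : ℕ) (hi : i < n) : z (i + 1) = x i := by simp [z, Nat.succ_le_iff.2 hi]
  have hzm : z (n + 1) = m := by simp [z]
  have hz : ∀ k, k < n + 1 → z (k + 1) < z k := by
    intro k hk
    rcases k with _ | k
    · rcases Nat.eq_zero_or_pos n with rfl | hn
      · rw [hzm, hz0]
        exact hm.trans_le (min_le_left _ _)
      · rw [hzx 0 hn, hz0]
        exact hM
    · rw [hzx k (by omega)]
      rcases (Nat.lt_succ_iff.1 hk).lt_or_eq with h | h
      · rw [hzx _ h]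
        exact hx.lt k (k + 1) (by omega) h
      · obtain rfl : k = n - 1 := by omega
        rw [h, hzm]
        exact hm.trans_le (min_le_right _ _)
  have hsign : ∀ k, k ≤ n + 1 → 0 < (-1) ^ k * (Ppoly c d (n + 1)).eval (z k) := by
    intro k hk
    rcases k with _ | k
    · simpa [hz0] using hMpos
    · rcases (Nat.le_of_succ_le_succ hk).lt_or_eq with h | rfl
      · rw [hzx _ h]
        exact hx.sign k h
      · rwa [hzm]
  obtain ⟨y, hy, hroots⟩ := exists_roots_between (hdeg (n + 1)).le hz hsign
  have hxy : ∀ i, i < n → y (i + 1) < x i ∧ x i < y i := fun i hi =>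
    hzx i hi ▸ ⟨(hy (i + 1) (by omega)).2, (hy i (by omega)).1⟩
  have hlt : ∀ i j, i < j → j < n + 1 → y j < y i := fun i j =>
    lt_of_succ_lt fun i hi => (hy (i + 1) hi).2.trans (hy i (by omega)).1
  refine ⟨y, ⟨hlt, hroots, fun k hk => ?_⟩, hxy⟩
  have hroot : (Ppoly c d (n + 1)).eval (y k) = 0 := by
    refine isRoot_of_mem_roots ?_
    rw [hroots]
    exact Multiset.mem_map_of_mem y (Multiset.mem_range.2 hk)
  have hprod : 0 < (-1) ^ k * ∏ i ∈ Finset.range n, (y k - x i) := by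
    refine neg_one_pow_mul_prod_sub_pos (Nat.lt_succ_iff.1 hk) (fun i hi => ?_) fun i hi hin => ?_
    · refine lt_of_le_of_lt ?_ (hxy i (by omega)).1
      rcases (Nat.succ_le_iff.2 hi).lt_or_eq with h | h
      · exact (hlt _ _ h hk).le
      · exact (congrArg y h).ge
    · refine (hxy i hin).2.trans_le ?_
      rcases hi.lt_or_eq with h | h
      · exact (hlt _ _ h (by omega)).le
      · exact (congrArg y h).ge
  have heval : (-1) ^ (k + 1) * (Ppoly c d (n + 2)).eval (y k)
      = d (n + 2) * (y k ^ 2 + 1) * ((Ppoly c d n).coeff n *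
        ((-1) ^ k * ∏ i ∈ Finset.range n, (y k - x i))) := by
    rw [Ppoly_add_two]
    simp only [eval_sub, eval_mul, eval_add, eval_pow, eval_X, eval_C, eval_one, hroot,
      eval_eq_coeff_mul_prod (hdeg n) hx.roots_eq]
    ring
  rw [heval]
  have := hpos n
  positivity

theorem stmt4 (c ℓ d : ℕ → ℝ)
    (hℓ1 : ℓ 1 = 0)
    (hℓ : ∀ n, 2 ≤ n → 0 < ℓ n ∧ ℓ n < 1)
    (hd : ∀ n, 1 ≤ n → d (n + 1) = (1 - ℓ n) * ℓ (n + 1)) :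
    ∃ x : ℕ → ℕ → ℝ,
      ∀ n, 1 ≤ n →
        -- the zeros are listed in decreasing order (hence distinct)
        (∀ j, 1 ≤ j → j < n → x n (j + 1) < x n j) ∧
        -- each `x_j^{(n)}` is a zero of `P_n`
        (∀ j, 1 ≤ j → j ≤ n → (Ppoly c d n).IsRoot (x n j)) ∧
        -- every real zero of `P_n` is one of them
        (∀ t : ℝ, (Ppoly c d n).IsRoot t → ∃ j, 1 ≤ j ∧ j ≤ n ∧ t = x n j) ∧
        -- `P_n` has exactly `n` real zeros counted with multiplicity
        (Ppoly c d n).roots.card = n ∧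
        -- each zero is simple
        (∀ j, 1 ≤ j → j ≤ n → (Ppoly c d n).rootMultiplicity (x n j) = 1) ∧
        -- interlacing of the zeros of `P_n` and `P_{n+1}`
        (∀ j, 1 ≤ j → j ≤ n → x (n + 1) (j + 1) < x n j ∧ x n j < x (n + 1) j) := by
  have hstep (n : ℕ) (x : ℕ → ℝ) (hx : IsZeroList c d n x) :=
    hx.exists_succ (coeff_Ppoly_self_pos hℓ1 hℓ hd) (chain_sequence_pos hℓ1 hℓ hd n)
  choose next hnext hinter using hstep
  let z : ∀ n, {x : ℕ → ℝ // IsZeroList c d n x} := fun n =>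
    Nat.rec ⟨0, isZeroList_zero c d 0⟩ (fun n x => ⟨next n x.1 x.2, hnext n x.1 x.2⟩) n
  refine ⟨fun n j => (z n).1 (j - 1), fun n hn => ?_⟩
  have hz := (z n).2
  have hP : Ppoly c d n ≠ 0 := by
    intro h
    have := coeff_Ppoly_self_pos (c := c) hℓ1 hℓ hd n
    simp [h] at this
  have hnodup : (Ppoly c d n).roots.Nodup := by
    rw [hz.roots_eq]
    exact nodup_map_range_of_lt hz.lt
  have hmem (j : ℕ) (hj : 1 ≤ j) (hjn : j ≤ n) : (z n).1 (j - 1) ∈ (Ppoly c d n).roots := by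
    rw [hz.roots_eq]
    exact Multiset.mem_map_of_mem _ (Multiset.mem_range.2 (by omega))
  refine ⟨fun j hj hjn => hz.lt _ _ (by omega) (by omega),
    fun j hj hjn => isRoot_of_mem_roots (hmem j hj hjn), fun t ht => ?_, by simp [hz.roots_eq],
    fun j hj hjn => ?_, fun j hj hjn => ?_⟩
  · have ht' := (mem_roots hP).2 ht
    rw [hz.roots_eq] at ht'
    obtain ⟨k, hk, rfl⟩ := Multiset.mem_map.1 ht'
    rw [Multiset.mem_range] at hk
    exact ⟨k + 1, by omega, hk, rfl⟩
  · rw [← count_roots]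
    exact Multiset.count_eq_one_of_mem hnodup (hmem j hj hjn)
  · have h := hinter n (z n).1 hz (j - 1) (by omega)
    rwa [Nat.sub_add_cancel hj] at h
end

section
/- Fix n ≥ 2. If c_1 > √(d_2), c_j > √(d_j) + √(d_{j+1}) for j = 2, 3, …, n−1, and c_n > √(d_n), then all zeros of P_n are positive real numbers. -/
open Polynomial

open ComplexConjugate in
/-- The Hermitian form of the tridiagonal matrix with diagonal `1` and off-diagonal entries `-e k`,
restricted to the first `m + 1` coordinates of `u`. -/
noncomputable def massForm (e : ℕ → ℝ) (u : ℕ → ℂ) (m : ℕ) : ℝ :=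
  ∑ k ∈ Finset.range (m + 1), Complex.normSq (u k)
    - ∑ k ∈ Finset.range m, 2 * e k * (u (k + 1) * conj (u k)).re

open ComplexConjugate in
/-- The Hermitian form of the tridiagonal matrix with diagonal `a k` and off-diagonal entries
`∓ i e k`, restricted to the first `m + 1` coordinates of `u`. -/
noncomputable def stiffnessForm (a e : ℕ → ℝ) (u : ℕ → ℂ) (m : ℕ) : ℝ :=
  ∑ k ∈ Finset.range (m + 1), a k * Complex.normSq (u k)
    + ∑ k ∈ Finset.range m, 2 * e k * (u (k + 1) * conj (u k)).im

open ComplexConjugate in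
lemma massForm_succ (e : ℕ → ℝ) (u : ℕ → ℂ) (m : ℕ) :
    massForm e u (m + 1) = massForm e u m + Complex.normSq (u (m + 1))
      - 2 * e m * (u (m + 1) * conj (u m)).re := by
  simp only [massForm, Finset.sum_range_succ]
  ring

open ComplexConjugate in
lemma stiffnessForm_succ (a e : ℕ → ℝ) (u : ℕ → ℂ) (m : ℕ) :
    stiffnessForm a e u (m + 1) = stiffnessForm a e u m + a (m + 1) * Complex.normSq (u (m + 1))
      + 2 * e m * (u (m + 1) * conj (u m)).im := by
  simp only [stiffnessForm, Finset.sum_range_succ]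
  ring

open ComplexConjugate in
/-- Green's formula for the three-term recurrence. -/
lemma mul_massForm_sub_stiffnessForm (a e : ℕ → ℝ) (u : ℕ → ℂ) (z : ℂ)
    (h0 : (z - Complex.I) * e 0 * u 1 = (z - a 0) * u 0)
    (hu : ∀ k, (z - Complex.I) * e (k + 1) * u (k + 2) =
      (z - a (k + 1)) * u (k + 1) - e k * (z + Complex.I) * u k) (m : ℕ) :
    z * massForm e u m - stiffnessForm a e u m =
      (z - Complex.I) * e m * u (m + 1) * conj (u m) := by
  induction m with
  | zero =>
    simp only [massForm, stiffnessForm, zero_add, Finset.sum_range_one, Finset.sum_range_zero,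
      sub_zero, add_zero, Complex.ofReal_mul, h0, Complex.normSq_eq_conj_mul_self]
    ring
  | succ m ih =>
    have key : z * (2 * ((u (m + 1) * conj (u m)).re : ℂ))
        + 2 * ((u (m + 1) * conj (u m)).im : ℂ)
        = (z - Complex.I) * (u (m + 1) * conj (u m))
          + (z + Complex.I) * (u m * conj (u (m + 1))) := by
      apply Complex.ext <;> simp <;> ring
    rw [massForm_succ, stiffnessForm_succ, hu m]
    push_cast
    rw [Complex.normSq_eq_conj_mul_self]
    linear_combination ih - (e m : ℂ) * key

lemma two_mul_mul_norm_le (x y : ℂ) {e α β : ℝ} (he : 0 ≤ e) (hα : 0 ≤ α) (hβ : 0 ≤ β)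
    (h : e ^ 2 = α * β) :
    2 * e * ‖x * y‖ ≤ α * Complex.normSq y + β * Complex.normSq x := by
  have hs : e = √α * √β := by
    rw [← Real.sqrt_mul hα, ← h, Real.sqrt_sq he]
  rw [Complex.normSq_eq_norm_sq, Complex.normSq_eq_norm_sq, norm_mul, hs]
  nlinarith [sq_nonneg (√α * ‖y‖ - √β * ‖x‖), Real.sq_sqrt hα, Real.sq_sqrt hβ]

/-- A chain sequence bounds the mass form from below by its last coordinate. -/
lemma le_massForm (e ℓ : ℕ → ℝ) (u : ℕ → ℂ) (he : ∀ k, 0 ≤ e k) (h0 : ℓ 0 = 0)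
    (hℓ : ∀ k, 0 ≤ ℓ k ∧ ℓ k ≤ 1) (hchain : ∀ k, e k ^ 2 = (1 - ℓ k) * ℓ (k + 1)) (m : ℕ) :
    (1 - ℓ m) * Complex.normSq (u m) ≤ massForm e u m := by
  induction m with
  | zero => simp [massForm, h0]
  | succ m ih =>
    rw [massForm_succ]
    have h1 := two_mul_mul_norm_le (u (m + 1)) (starRingEnd ℂ (u m)) (he m)
      (sub_nonneg.2 (hℓ m).2) (hℓ (m + 1)).1 (hchain m)
    have h2 := mul_le_mul_of_nonneg_left
      (Complex.re_le_norm (u (m + 1) * starRingEnd ℂ (u m))) (mul_nonneg zero_le_two (he m))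
    rw [Complex.normSq_conj] at h1
    linarith

lemma stiffnessForm_succ_ge (a e : ℕ → ℝ) (u : ℕ → ℂ) (he : ∀ k, 0 ≤ e k) (m : ℕ) :
    stiffnessForm a e u m - e m * Complex.normSq (u m)
        + (a (m + 1) - e m) * Complex.normSq (u (m + 1)) ≤ stiffnessForm a e u (m + 1) := by
  rw [stiffnessForm_succ]
  have h1 := two_mul_mul_norm_le (u (m + 1)) (starRingEnd ℂ (u m)) (he m) (he m) (he m)
    (sq (e m))
  have h2 := mul_le_mul_of_nonneg_left
    (neg_le_of_abs_le (Complex.abs_im_le_norm (u (m + 1) * starRingEnd ℂ (u m))))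
    (mul_nonneg zero_le_two (he m))
  rw [Complex.normSq_conj] at h1
  linarith

/-- Diagonal dominance makes the stiffness form positive. -/
lemma stiffnessForm_pos (a e : ℕ → ℝ) (u : ℕ → ℂ) (he : ∀ k, 0 ≤ e k) (hu0 : u 0 ≠ 0) (m : ℕ)
    (h0 : e 0 < a 0) (hmid : ∀ k, k < m → e k + e (k + 1) ≤ a (k + 1))
    (hlast : e m ≤ a (m + 1)) :
    0 < stiffnessForm a e u (m + 1) := by
  have hdom : ∀ k, k ≤ m → 0 < stiffnessForm a e u k - e k * Complex.normSq (u k) := by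
    intro k hk
    induction k with
    | zero =>
      have := mul_pos (sub_pos.2 h0) (Complex.normSq_pos.2 hu0)
      simp only [stiffnessForm, zero_add, Finset.sum_range_one, Finset.sum_range_zero, add_zero]
      linarith
    | succ k ih =>
      have h1 := ih (by omega)
      have h2 := stiffnessForm_succ_ge a e u he k
      have h3 := mul_nonneg (sub_nonneg.2 (hmid k (by omega))) (Complex.normSq_nonneg (u (k + 1)))
      linarith
  have h1 := hdom m le_rfl
  have h2 := stiffnessForm_succ_ge a e u he m
  have h3 := mul_nonneg (sub_nonneg.2 hlast) (Complex.normSq_nonneg (u (m + 1)))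
  linarith

lemma aeval_Ppoly_one (c d : ℕ → ℝ) (z : ℂ) : aeval z (Ppoly c d 1) = z - c 1 := by
  simp [Ppoly]

lemma aeval_Ppoly_add_two (c d : ℕ → ℝ) (z : ℂ) (k : ℕ) :
    aeval z (Ppoly c d (k + 2)) = (z - c (k + 2)) * aeval z (Ppoly c d (k + 1))
      - d (k + 2) * (z ^ 2 + 1) * aeval z (Ppoly c d k) := by
  simp [Ppoly]

lemma aeval_I_Ppoly_ne_zero (c d : ℕ → ℝ) (n : ℕ) : aeval Complex.I (Ppoly c d n) ≠ 0 := by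
  have hne : ∀ r : ℝ, Complex.I - r ≠ 0 := fun r h => by
    simpa using congrArg Complex.im h
  induction n with
  | zero => simp [Ppoly]
  | succ n ih =>
    cases n with
    | zero => simpa only [zero_add, aeval_Ppoly_one] using hne (c 1)
    | succ n =>
      rw [aeval_Ppoly_add_two, Complex.I_sq, neg_add_cancel, mul_zero, zero_mul, sub_zero]
      exact mul_ne_zero (hne _) ih

theorem stmt5 (c ℓ d : ℕ → ℝ)
    (hℓ1 : ℓ 1 = 0)
    (hℓ : ∀ n, 2 ≤ n → 0 < ℓ n ∧ ℓ n < 1)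
    (hd : ∀ n, 1 ≤ n → d (n + 1) = (1 - ℓ n) * ℓ (n + 1))
    (n : ℕ) (hn : 2 ≤ n)
    (h1 : Real.sqrt (d 2) < c 1)
    (hj : ∀ j, 2 ≤ j → j ≤ n - 1 → Real.sqrt (d j) + Real.sqrt (d (j + 1)) < c j)
    (hlast : Real.sqrt (d n) < c n) :
    ∀ z : ℂ, Polynomial.aeval z (Ppoly c d n) = 0 → z.im = 0 ∧ 0 < z.re := by
  intro z hz
  obtain ⟨m, rfl⟩ : ∃ m, n = m + 2 := ⟨n - 2, by omega⟩
  have hℓ' : ∀ k, 0 ≤ ℓ (k + 1) ∧ ℓ (k + 1) < 1 := by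
    rintro (_ | k)
    · simp [hℓ1]
    · exact (hℓ (k + 2) (by omega)).imp_left le_of_lt
  have hdpos : ∀ k, 0 < d (k + 2) := fun k => by
    rw [hd (k + 1) (by omega)]
    exact mul_pos (sub_pos.2 (hℓ' k).2) (hℓ (k + 2) (by omega)).1
  have hw : z - Complex.I ≠ 0 := fun h => by
    rw [sub_eq_zero.1 h] at hz
    exact aeval_I_Ppoly_ne_zero c d _ hz
  set e : ℕ → ℝ := fun k => √(d (k + 2))
  have he : ∀ k, 0 < e k := fun k => Real.sqrt_pos.2 (hdpos k)
  have hsq : ∀ k, e k ^ 2 = d (k + 2) := fun k => Real.sq_sqrt (hdpos k).le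
  have heC : ∀ k, (e k : ℂ) ≠ 0 := fun k => Complex.ofReal_ne_zero.2 (he k).ne'
  set s : ℕ → ℂ := fun k => ∏ j ∈ Finset.range k, (z - Complex.I) * e j
  have hs : ∀ k, s k ≠ 0 := fun k => Finset.prod_ne_zero_iff.2 fun j _ => mul_ne_zero hw (heC j)
  have hs_succ : ∀ k, s (k + 1) = s k * ((z - Complex.I) * e k) := fun k =>
    Finset.prod_range_succ _ _
  set u : ℕ → ℂ := fun k => aeval z (Ppoly c d k) / s k with hu_def
  have hp : ∀ k, aeval z (Ppoly c d k) = s k * u k := fun k => (mul_div_cancel₀ _ (hs k)).symm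
  have hs0 : s 0 = 1 := Finset.prod_range_zero _
  have hu0 : u 0 = 1 := by simp [hu_def, hs0, Ppoly]
  have hu1 : (z - Complex.I) * e 0 * u 1 = (z - c (0 + 1)) * u 0 := by
    have := hp 1
    rw [aeval_Ppoly_one, hs_succ 0, hs0] at this
    rw [hu0]
    linear_combination -this
  have hrec : ∀ k, (z - Complex.I) * e (k + 1) * u (k + 2) =
      (z - c (k + 1 + 1)) * u (k + 1) - e k * (z + Complex.I) * u k := fun k => by
    have h := aeval_Ppoly_add_two c d z k
    rw [hp, hp, hp, hs_succ (k + 1), hs_succ k, ← hsq k] at h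
    push_cast at h
    apply mul_left_cancel₀ (mul_ne_zero (hs k) (mul_ne_zero hw (heC k)))
    linear_combination h - (e k : ℂ) ^ 2 * s k * u k * Complex.I_sq
  have hgreen := mul_massForm_sub_stiffnessForm (fun k => c (k + 1)) e u z hu1 hrec (m + 1)
  have hlastu : u (m + 1 + 1) = 0 := by simp [hu_def, hz]
  rw [hlastu, mul_zero, zero_mul, sub_eq_zero] at hgreen
  have hB : 0 < stiffnessForm (fun k => c (k + 1)) e u (m + 1) :=
    stiffnessForm_pos _ e u (fun k => (he k).le) (by simp [hu0]) m h1
      (fun k hk => (hj (k + 2) (by omega) (by omega)).le) hlast.le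
  have hA : 0 ≤ massForm e u (m + 1) :=
    (mul_nonneg (sub_nonneg.2 (hℓ' (m + 1)).2.le) (Complex.normSq_nonneg _)).trans
      (le_massForm e (fun k => ℓ (k + 1)) u (fun k => (he k).le) hℓ1
        (fun k => (hℓ' k).imp_right le_of_lt)
        (fun k => (hsq k).trans (hd (k + 1) (by omega))) (m + 1))
  have hre := congrArg Complex.re hgreen
  have him := congrArg Complex.im hgreen
  rw [Complex.re_mul_ofReal, Complex.ofReal_re] at hre
  rw [Complex.im_mul_ofReal, Complex.ofReal_im] at him
  have hzA : 0 < z.re * massForm e u (m + 1) := hre ▸ hB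
  exact ⟨(mul_eq_zero.1 him).resolve_right (right_ne_zero_of_mul hzA.ne'),
    pos_of_mul_pos_left hzA hA⟩
end

section
/- Fix n ≥ 2. If c_1 < −√(d_2), c_j < −√(d_j) − √(d_{j+1}) for j = 2, 3, …, n−1, and c_n < −√(d_n), then all zeros of P_n are negative real numbers. -/
open Polynomial

open ComplexConjugate

/-- The binary quadratic form `a x² + 2 s x y + b y²` is nonnegative when `s² = a b`, `a > 0`. -/
lemma quadratic_form_nonneg {a b s : ℝ} (ha : 0 < a) (hs : s ^ 2 = a * b) (x y : ℝ) :
    0 ≤ a * x ^ 2 + 2 * s * x * y + b * y ^ 2 := by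
  refine nonneg_of_mul_nonneg_right (a := a) ?_ ha
  have h : a * (a * x ^ 2 + 2 * s * x * y + b * y ^ 2) = (a * x + s * y) ^ 2 := by
    linear_combination (-y ^ 2) * hs
  rw [h]
  positivity

/-- Adding one row of the tridiagonal pencil `z B - A` to the quadratic forms of its leading
block. Here `q`, `p` are consecutive entries of the vector, `c` is the new diagonal entry of `A`
and `s` the modulus of the new off-diagonal entries. -/
lemma pencil_forms_step {z p q r : ℂ} {A B c s l l' : ℝ} (hs : 0 ≤ s) (hl : l < 1)
    (hsl : s ^ 2 = (1 - l) * l')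
    (hform : z * B - A + s * (z - Complex.I) * p * conj q = 0)
    (hrow : s * (z + Complex.I) * q + (z - c) * p + r = 0)
    (hB : (1 - l) * Complex.normSq q ≤ B) :
    ∃ A' B' : ℝ, z * B' - A' + r * conj p = 0 ∧ (1 - l') * Complex.normSq p ≤ B' ∧
      A' ≤ A + s * Complex.normSq q + (c + s) * Complex.normSq p := by
  refine ⟨A + c * Complex.normSq p - 2 * s * (p.im * q.re - p.re * q.im),
    B + Complex.normSq p + 2 * s * (q.re * p.re + q.im * p.im), ?_, ?_, ?_⟩
  · have hp : ((Complex.normSq p : ℝ) : ℂ) = p * conj p := (Complex.mul_conj p).symm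
    have hre : (2 * (q.re * p.re + q.im * p.im) : ℂ) = q * conj p + p * conj q := by
      apply Complex.ext <;> simp <;> ring
    have him : (-2 * (p.im * q.re - p.re * q.im) : ℂ)
        = Complex.I * (p * conj q - q * conj p) := by
      apply Complex.ext <;> simp <;> ring
    push_cast
    rw [hp]
    linear_combination hform + conj p * hrow + z * s * hre - s * him
  · have h1 := quadratic_form_nonneg (sub_pos.2 hl) hsl q.re p.re
    have h2 := quadratic_form_nonneg (sub_pos.2 hl) hsl q.im p.im
    rw [Complex.normSq_apply] at hB ⊢
    nlinarith
  · rw [Complex.normSq_apply, Complex.normSq_apply]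
    nlinarith [mul_nonneg hs (sq_nonneg (p.im + q.re)), mul_nonneg hs (sq_nonneg (p.im - q.re)),
      mul_nonneg hs (sq_nonneg (p.re - q.im)), mul_nonneg hs (sq_nonneg (p.re + q.im))]

lemma aeval_Ppoly_succ_succ (c d : ℕ → ℝ) (n : ℕ) (z : ℂ) :
    aeval z (Ppoly c d (n + 2)) = (z - c (n + 2)) * aeval z (Ppoly c d (n + 1))
      - d (n + 2) * (z ^ 2 + 1) * aeval z (Ppoly c d n) := by
  simp [Ppoly]

lemma aeval_Ppoly_ne_zero_of_sq_add_one_eq_zero (c d : ℕ → ℝ) {z : ℂ} (hz : z ^ 2 + 1 = 0)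
    (n : ℕ) : aeval z (Ppoly c d n) ≠ 0 := by
  have hne (x : ℝ) : z - x ≠ 0 := by
    intro h
    rw [sub_eq_zero.1 h] at hz
    have : x ^ 2 + 1 = 0 := by exact_mod_cast hz
    linarith [sq_nonneg x]
  induction n using Nat.twoStepInduction with
  | zero => simp [Ppoly]
  | one => simpa [Ppoly] using hne (c 1)
  | more n _ ih =>
    rw [aeval_Ppoly_succ_succ, hz, mul_zero, zero_mul, sub_zero]
    exact mul_ne_zero (hne _) ih

/-- Away from `±i`, the values of the `P_k` can be rescaled to a vector annihilated by the
rows of a tridiagonal pencil. -/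
lemma exists_pencil_vector (c d : ℕ → ℝ) (hd : ∀ k, 0 < d (k + 2)) {z : ℂ}
    (hz : z ^ 2 + 1 ≠ 0) :
    ∃ w : ℕ → ℂ, w 0 = 1 ∧ (∀ k, aeval z (Ppoly c d k) = 0 → w k = 0) ∧
      (z - c 1) * w 0 + √(d 2) * (z - Complex.I) * w 1 = 0 ∧
      ∀ k, √(d (k + 2)) * (z + Complex.I) * w k + (z - c (k + 2)) * w (k + 1)
        + √(d (k + 3)) * (z - Complex.I) * w (k + 2) = 0 := by
  have hzI : z - Complex.I ≠ 0 := by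
    intro h
    apply hz
    rw [sub_eq_zero.1 h]
    simp
  have hs (k : ℕ) : (√(d (k + 2)) : ℂ) ≠ 0 := by
    exact_mod_cast (Real.sqrt_pos.2 (hd k)).ne'
  have hsq (k : ℕ) : (√(d (k + 2)) : ℂ) ^ 2 = d (k + 2) := by
    exact_mod_cast Real.sq_sqrt (hd k).le
  let u : ℕ → ℂ := fun k => ∏ j ∈ Finset.range k, (-(√(d (j + 2)) : ℂ) * (z - Complex.I))
  have hu (k : ℕ) : u k ≠ 0 :=
    Finset.prod_ne_zero_iff.2 fun j _ => mul_ne_zero (neg_ne_zero.2 (hs j)) hzI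
  have hus (k : ℕ) : u (k + 1) = u k * (-(√(d (k + 2)) : ℂ) * (z - Complex.I)) :=
    Finset.prod_range_succ _ _
  have hu0 : u 0 = 1 := Finset.prod_range_zero _
  refine ⟨fun k => aeval z (Ppoly c d k) / u k, ?_, fun k hk => ?_, ?_, fun k => ?_⟩
  · simp [Ppoly, hu0]
  · simp [hk]
  · have h := hs 0
    simp only [zero_add] at h
    simp only [hus 0, hu0, zero_add, Ppoly, map_one, map_sub, aeval_X, aeval_C,
      Complex.coe_algebraMap]
    field_simp
    ring
  · have h0 := hs k
    have h1 := hs (k + 1)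
    have hk := hu k
    simp only [hus, aeval_Ppoly_succ_succ, ← hsq, show k + 1 + 2 = k + 3 from rfl] at h1 ⊢
    field_simp
    linear_combination
      -(√(d (k + 2)) : ℂ) ^ 2 * aeval z (Ppoly c d k) * Complex.I_sq

theorem stmt6 (c ℓ d : ℕ → ℝ)
    (hℓ1 : ℓ 1 = 0)
    (hℓ : ∀ n, 2 ≤ n → 0 < ℓ n ∧ ℓ n < 1)
    (hd : ∀ n, 1 ≤ n → d (n + 1) = (1 - ℓ n) * ℓ (n + 1))
    (n : ℕ) (hn : 2 ≤ n)
    (h1 : c 1 < -Real.sqrt (d 2))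
    (hj : ∀ j, 2 ≤ j → j ≤ n - 1 → c j < -Real.sqrt (d j) - Real.sqrt (d (j + 1)))
    (hlast : c n < -Real.sqrt (d n)) :
    ∀ z : ℂ, Polynomial.aeval z (Ppoly c d n) = 0 → z.im = 0 ∧ z.re < 0 := by
  intro z hPn
  have hl1 (k : ℕ) : ℓ (k + 1) < 1 := by
    rcases k with _ | k
    · simp [hℓ1]
    · exact (hℓ (k + 2) (by lia)).2
  have hdpos (k : ℕ) : 0 < d (k + 2) := by
    rw [hd (k + 1) (by lia)]
    exact mul_pos (sub_pos.2 (hl1 k)) (hℓ (k + 2) (by lia)).1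
  have hsq (k : ℕ) : √(d (k + 2)) ^ 2 = (1 - ℓ (k + 1)) * ℓ (k + 2) := by
    rw [Real.sq_sqrt (hdpos k).le, hd (k + 1) (by lia)]
  have hz : z ^ 2 + 1 ≠ 0 := fun h => aeval_Ppoly_ne_zero_of_sq_add_one_eq_zero c d h n hPn
  obtain ⟨w, hw0, hwP, hfirst, hrow⟩ := exists_pencil_vector c d hdpos hz
  have hforms (m : ℕ) (hm : m + 2 ≤ n) : ∃ A B : ℝ,
      z * B - A + √(d (m + 2)) * (z - Complex.I) * w (m + 1) * conj (w m) = 0 ∧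
      (1 - ℓ (m + 1)) * Complex.normSq (w m) ≤ B ∧
      A + √(d (m + 2)) * Complex.normSq (w m) < 0 := by
    induction m with
    | zero =>
      refine ⟨c 1, 1, ?_, ?_, ?_⟩
      · simp only [hw0, zero_add, map_one, Complex.ofReal_one] at hfirst ⊢
        linear_combination hfirst
      · simp [hw0, hℓ1]
      · simp only [hw0, map_one, zero_add]
        linarith
    | succ m ih =>
      obtain ⟨A, B, hform, hB, hA⟩ := ih (by lia)
      obtain ⟨A', B', hform', hB', hA'⟩ := pencil_forms_step (Real.sqrt_nonneg _) (hl1 m)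
        (hsq m) hform (hrow m) hB
      refine ⟨A', B', hform', hB', ?_⟩
      have hc := hj (m + 2) (by lia) (by lia)
      have hmul := mul_nonneg (sub_nonneg.2 hc.le) (Complex.normSq_nonneg (w (m + 1)))
      simp only [show m + 2 + 1 = m + 3 from rfl] at hmul ⊢
      linarith
  obtain ⟨m, rfl⟩ := Nat.exists_eq_add_of_le' hn
  obtain ⟨A, B, hform, hB, hA⟩ := hforms m le_rfl
  obtain ⟨A', B', hform', hB', hA'⟩ := pencil_forms_step (Real.sqrt_nonneg _) (hl1 m)
    (hsq m) hform (hrow m) hB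
  have hA'neg : A' < 0 := by
    have hmul := mul_nonneg (sub_nonneg.2 hlast.le) (Complex.normSq_nonneg (w (m + 1)))
    linarith
  have hB'nonneg : 0 ≤ B' :=
    (mul_nonneg (sub_nonneg.2 (hl1 (m + 1)).le) (Complex.normSq_nonneg _)).trans hB'
  rw [hwP _ hPn, mul_zero, zero_mul, add_zero, sub_eq_zero] at hform'
  have hre : z.re * B' = A' := by simpa using congrArg Complex.re hform'
  have him : z.im * B' = 0 := by simpa using congrArg Complex.im hform'
  have hB'ne : B' ≠ 0 := by
    rintro rfl
    linarith
  exact ⟨(mul_eq_zero.1 him).resolve_right hB'ne,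
    neg_of_mul_neg_left (hre.trans_lt hA'neg) hB'nonneg⟩
end

section
/- Let P_n be defined by the recurrence with c_n = 0 and d_{n+1} = 1/4 for all n ≥ 1 (so P_0(x) = 1, P_1(x) = x, P_{n+1}(x) = x P_n(x) − (1/4)(x² + 1)P_{n−1}(x)). Then for every n ≥ 0, P_n(x) = i((x − i)/2)^{n+1} − i((x + i)/2)^{n+1}, and for every n ≥ 0 and every integer 0 ≤ k ≤ n: (1/π) ∫_ℝ x^k P_n(x)/(x² + 1)^{n+1} dx = 2^{−n} δ_{n,k}. -/
open Polynomial MeasureTheory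

/-- The closed form of `P_n` for `c = 0` and `d = 1/4`. -/
theorem aeval_Ppoly_zero_quarter (n : ℕ) (z : ℂ) :
    Polynomial.aeval z (Ppoly (fun _ => 0) (fun _ => 1 / 4) n) =
      Complex.I * ((z - Complex.I) / 2) ^ (n + 1) -
        Complex.I * ((z + Complex.I) / 2) ^ (n + 1) := by
  induction n using Nat.twoStepInduction with
  | zero =>
    simp only [Ppoly, map_one]
    linear_combination Complex.I_sq
  | one =>
    simp only [Ppoly, map_sub, aeval_X, map_zero]
    linear_combination z * Complex.I_sq
  | more n h0 h1 =>
    simp only [Ppoly, map_sub, map_mul, map_add, map_pow, map_one, aeval_X, aeval_C, h0, h1]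
    simp only [map_zero, map_div₀, map_one, map_ofNat]
    linear_combination (-1 / 4 * (Complex.I * ((z - Complex.I) / 2) ^ (n + 1) -
        Complex.I * ((z + Complex.I) / 2) ^ (n + 1))) * Complex.I_sq

/-- The imaginary part of `(x - i)⁻ᵐ` on the real line. -/
noncomputable def imInvPow (m : ℕ) (x : ℝ) : ℝ := (((x : ℂ) - Complex.I)⁻¹ ^ m).im

theorem ofReal_sub_I_ne_zero (x : ℝ) : (x : ℂ) - Complex.I ≠ 0 := by
  intro h
  simpa using congrArg Complex.im h

theorem normSq_ofReal_sub_I (x : ℝ) : Complex.normSq ((x : ℂ) - Complex.I) = x ^ 2 + 1 := by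
  simp [Complex.normSq_apply]
  ring

theorem imInvPow_zero (x : ℝ) : imInvPow 0 x = 0 := by simp [imInvPow]

theorem imInvPow_one (x : ℝ) : imInvPow 1 x = (1 + x ^ 2)⁻¹ := by
  simp [imInvPow, Complex.inv_im, normSq_ofReal_sub_I, add_comm]

theorem hasDerivAt_imInvPow (m : ℕ) (x : ℝ) :
    HasDerivAt (imInvPow m) (-(m * imInvPow (m + 1) x)) x := by
  have h : HasDerivAt (fun z : ℂ => (z - Complex.I)⁻¹ ^ m)
      (-(m * ((x : ℂ) - Complex.I)⁻¹ ^ (m + 1))) (x : ℂ) := by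
    have h1 := (((hasDerivAt_id (x : ℂ)).sub_const Complex.I).inv (ofReal_sub_I_ne_zero x)).pow m
    refine h1.congr_deriv ?_
    rcases m with _ | m
    · simp
    · simp only [id, Pi.inv_apply, Nat.add_sub_cancel]
      rw [neg_div, one_div, ← inv_pow]
      ring
  refine (Complex.imCLM.hasFDerivAt.comp_hasDerivAt x h.comp_ofReal).congr_deriv ?_
  simp [imInvPow]

theorem abs_im_pow_succ_le (w : ℂ) (m : ℕ) :
    |(w ^ (m + 1)).im| ≤ (m + 1) * ‖w‖ ^ m * |w.im| := by
  induction m with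
  | zero => simp
  | succ m ih =>
    rw [pow_succ w (m + 1), Complex.mul_im]
    have h1 : |(w ^ (m + 1)).re * w.im| ≤ ‖w‖ ^ (m + 1) * |w.im| := by
      rw [abs_mul, ← norm_pow]
      gcongr
      exact Complex.abs_re_le_norm _
    have h2 : |(w ^ (m + 1)).im * w.re| ≤ ((m + 1) * ‖w‖ ^ m * |w.im|) * ‖w‖ := by
      rw [abs_mul]
      gcongr
      exact Complex.abs_re_le_norm _
    calc _ ≤ _ := abs_add_le _ _
      _ ≤ _ := add_le_add h1 h2
      _ = _ := by push_cast; ring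

theorem norm_inv_ofReal_sub_I_sq (x : ℝ) : ‖((x : ℂ) - Complex.I)⁻¹‖ ^ 2 = (1 + x ^ 2)⁻¹ := by
  rw [norm_inv, inv_pow, Complex.sq_norm, normSq_ofReal_sub_I, add_comm]

theorem norm_inv_ofReal_sub_I_le_one (x : ℝ) : ‖((x : ℂ) - Complex.I)⁻¹‖ ≤ 1 := by
  rw [← sq_le_one_iff₀ (norm_nonneg _), norm_inv_ofReal_sub_I_sq]
  exact inv_le_one_of_one_le₀ (by nlinarith [sq_nonneg x])

theorem abs_mul_norm_inv_ofReal_sub_I_le_one (x : ℝ) :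
    |x| * ‖((x : ℂ) - Complex.I)⁻¹‖ ≤ 1 := by
  rw [← sq_le_one_iff₀ (by positivity), mul_pow, norm_inv_ofReal_sub_I_sq, sq_abs,
    ← div_eq_mul_inv, div_le_one (by positivity)]
  linarith

theorem abs_pow_mul_norm_pow_le_one {k n : ℕ} (h : k ≤ n) (x : ℝ) :
    |x| ^ k * ‖((x : ℂ) - Complex.I)⁻¹‖ ^ n ≤ 1 := by
  obtain ⟨j, rfl⟩ := Nat.exists_eq_add_of_le h
  rw [pow_add, ← mul_assoc, ← mul_pow]
  exact mul_le_one₀ (pow_le_one₀ (by positivity) (abs_mul_norm_inv_ofReal_sub_I_le_one x))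
    (by positivity) (pow_le_one₀ (by positivity) (norm_inv_ofReal_sub_I_le_one x))

theorem abs_pow_mul_imInvPow_succ_le (k m : ℕ) (x : ℝ) :
    |x ^ k * imInvPow (m + 1) x| ≤
      (m + 1) * (|x| ^ k * ‖((x : ℂ) - Complex.I)⁻¹‖ ^ m) * (1 + x ^ 2)⁻¹ := by
  have h := abs_im_pow_succ_le ((x : ℂ) - Complex.I)⁻¹ m
  have h1 : (((x : ℂ) - Complex.I)⁻¹).im = (1 + x ^ 2)⁻¹ := by
    simpa [imInvPow] using imInvPow_one x
  rw [h1, abs_of_nonneg (by positivity : (0 : ℝ) ≤ (1 + x ^ 2)⁻¹)] at h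
  rw [abs_mul, abs_pow]
  calc _ ≤ |x| ^ k * ((m + 1) * ‖((x : ℂ) - Complex.I)⁻¹‖ ^ m * (1 + x ^ 2)⁻¹) := by
        gcongr
        exact h
    _ = _ := by ring

theorem integrable_pow_mul_imInvPow {k n : ℕ} (h : k ≤ n) :
    Integrable fun x : ℝ => x ^ k * imInvPow (n + 1) x := by
  have hc : Continuous (imInvPow (n + 1)) :=
    continuous_iff_continuousAt.2 fun x => (hasDerivAt_imInvPow _ x).continuousAt
  refine (integrable_inv_one_add_sq.const_mul ((n : ℝ) + 1)).mono'
    (by fun_prop) (Filter.Eventually.of_forall fun x => ?_)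
  rw [Real.norm_eq_abs]
  refine (abs_pow_mul_imInvPow_succ_le k n x).trans ?_
  gcongr
  exact mul_le_of_le_one_right (by positivity) (abs_pow_mul_norm_pow_le_one h x)

theorem abs_pow_mul_imInvPow_le {k m : ℕ} (h : k ≤ m) {x : ℝ} (hx : x ≠ 0) :
    |x ^ k * imInvPow m x| ≤ m * |x|⁻¹ := by
  rcases m with _ | m
  · simp [imInvPow_zero]
  have hx' : 0 < |x| := abs_pos.2 hx
  refine (abs_pow_mul_imInvPow_succ_le k m x).trans ?_
  have h1 := abs_pow_mul_norm_pow_le_one h x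
  rw [← norm_inv_ofReal_sub_I_sq]
  have h2 : ‖((x : ℂ) - Complex.I)⁻¹‖ ≤ |x|⁻¹ := by
    rw [← one_div |x|, le_div_iff₀ hx', mul_comm]
    exact abs_mul_norm_inv_ofReal_sub_I_le_one x
  calc _ = ((m : ℝ) + 1) * (|x| ^ k * ‖((x : ℂ) - Complex.I)⁻¹‖ ^ (m + 1)) *
        ‖((x : ℂ) - Complex.I)⁻¹‖ := by ring
    _ ≤ (m + 1) * 1 * |x|⁻¹ := by gcongr
    _ = _ := by push_cast; ring

theorem tendsto_pow_mul_imInvPow {k m : ℕ} (h : k ≤ m) {l : Filter ℝ}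
    (hl : Filter.Tendsto (fun x : ℝ => |x|) l Filter.atTop) :
    Filter.Tendsto (fun x : ℝ => x ^ k * imInvPow m x) l (nhds 0) := by
  refine squeeze_zero_norm' ((hl.eventually_gt_atTop 0).mono fun x hx =>
    abs_pow_mul_imInvPow_le h (abs_pos.1 hx)) ?_
  simpa using (tendsto_inv_atTop_zero.comp hl).const_mul (m : ℝ)

theorem integral_eq_zero_of_hasDerivAt_pow_mul_imInvPow {k m : ℕ} (h : k ≤ m) {f : ℝ → ℝ}
    (hd : ∀ x, HasDerivAt (fun x : ℝ => x ^ k * imInvPow m x) (f x) x) (hf : Integrable f) :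
    ∫ x, f x = 0 := by
  simpa using integral_of_hasDerivAt_of_tendsto hd hf
    (tendsto_pow_mul_imInvPow h Filter.tendsto_abs_atBot_atTop)
    (tendsto_pow_mul_imInvPow h Filter.tendsto_abs_atTop_atTop)

theorem integral_imInvPow (n : ℕ) : ∫ x, imInvPow (n + 2) x = 0 := by
  have hi : Integrable fun x : ℝ => imInvPow (n + 2) x := by
    simpa using integrable_pow_mul_imInvPow (Nat.zero_le (n + 1))
  have h := integral_eq_zero_of_hasDerivAt_pow_mul_imInvPow (Nat.zero_le (n + 1))
    (fun x => by simpa using hasDerivAt_imInvPow (n + 1) x) (hi.const_mul (-((n : ℝ) + 1)) |>.congr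
      (Filter.Eventually.of_forall fun x => by
        show _ = -(((n : ℝ) + 1) * imInvPow (n + 1 + 1) x)
        ring))
  rw [integral_neg, integral_const_mul] at h
  have : (n : ℝ) + 1 ≠ 0 := by positivity
  simpa [this] using h

theorem integral_pow_succ_mul_imInvPow {k n : ℕ} (h : k ≤ n) :
    ((n : ℝ) + 1) * ∫ x, x ^ (k + 1) * imInvPow (n + 2) x =
      (k + 1) * ∫ x, x ^ k * imInvPow (n + 1) x := by
  have h1 := (integrable_pow_mul_imInvPow h).const_mul ((k : ℝ) + 1)
  have h2 := (integrable_pow_mul_imInvPow (Nat.succ_le_succ h)).const_mul ((n : ℝ) + 1)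
  have h3 := integral_eq_zero_of_hasDerivAt_pow_mul_imInvPow (Nat.succ_le_succ h)
    (fun x => ((hasDerivAt_pow (k + 1) x).mul (hasDerivAt_imInvPow (n + 1) x)).congr_deriv (by
      show _ = (((k : ℝ) + 1) * (x ^ k * imInvPow (n + 1) x)) -
        ((n : ℝ) + 1) * (x ^ (k + 1) * imInvPow (n + 1 + 1) x)
      simp only [Nat.add_sub_cancel]
      push_cast
      ring)) (h1.sub h2)
  simp only [Pi.sub_apply] at h3
  rw [integral_sub h1 h2, integral_const_mul, integral_const_mul] at h3
  linarith

theorem integral_pow_mul_imInvPow {k n : ℕ} (h : k ≤ n) :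
    ∫ x, x ^ k * imInvPow (n + 1) x = if n = k then Real.pi else 0 := by
  induction k generalizing n with
  | zero =>
    rcases n with _ | n
    · simp [imInvPow_one]
    · simpa using integral_imInvPow n
  | succ k ih =>
    obtain ⟨n, rfl⟩ : ∃ m, n = m + 1 := ⟨n - 1, by omega⟩
    have h1 := integral_pow_succ_mul_imInvPow (Nat.le_of_succ_le_succ h)
    rw [ih (Nat.le_of_succ_le_succ h)] at h1
    have hn : (n : ℝ) + 1 ≠ 0 := by positivity
    refine mul_left_cancel₀ hn (h1.trans ?_)
    by_cases e : n = k <;> simp [e]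

theorem eval_Ppoly_zero_quarter_div (n : ℕ) (x : ℝ) :
    (Ppoly (fun _ => 0) (fun _ => 1 / 4) n).eval x / (x ^ 2 + 1) ^ (n + 1) =
      1 / 2 ^ n * imInvPow (n + 1) x := by
  have hz := ofReal_sub_I_ne_zero x
  have hconj : (starRingEnd ℂ) ((x : ℂ) - Complex.I) = x + Complex.I := by simp
  have hinv : ((x : ℂ) - Complex.I)⁻¹ ^ (n + 1) =
      (x + Complex.I) ^ (n + 1) * (((x ^ 2 + 1) ^ (n + 1))⁻¹ : ℝ) := by
    rw [Complex.inv_def, hconj, normSq_ofReal_sub_I, mul_pow]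
    push_cast
    rw [inv_pow]
  have him : (((x : ℂ) - Complex.I) ^ (n + 1)).im = -((x + Complex.I) ^ (n + 1)).im := by
    rw [← hconj, ← map_pow, Complex.conj_im, neg_neg]
  have hP : (Ppoly (fun _ => 0) (fun _ => 1 / 4) n).eval x =
      1 / 2 ^ n * (((x : ℂ) + Complex.I) ^ (n + 1)).im := by
    have h := aeval_Ppoly_zero_quarter n (x : ℂ)
    have h0 : Polynomial.aeval (x : ℂ) (Ppoly (fun _ => 0) (fun _ => 1 / 4) n) =
        (((Ppoly (fun _ => 0) (fun _ => 1 / 4) n).eval x : ℝ) : ℂ) :=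
      Polynomial.aeval_algebraMap_apply_eq_algebraMap_eval x _
    have h2 : ∀ z : ℂ, (z / 2) ^ (n + 1) = z ^ (n + 1) * (((2 ^ (n + 1))⁻¹ : ℝ) : ℂ) := by
      intro z
      rw [div_pow, div_eq_mul_inv]
      push_cast
      rfl
    rw [h0, h2, h2] at h
    have hre := congrArg Complex.re h
    simp only [Complex.ofReal_re, Complex.sub_re, Complex.I_mul_re, Complex.im_mul_ofReal,
      him] at hre
    rw [hre]
    field_simp
    ring
  rw [hP, imInvPow, hinv, Complex.im_mul_ofReal]
  ring


theorem stmt19 :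
    (∀ n : ℕ, ∀ z : ℂ,
      Polynomial.aeval z (Ppoly (fun _ => 0) (fun _ => 1 / 4) n) =
        Complex.I * ((z - Complex.I) / 2) ^ (n + 1) -
          Complex.I * ((z + Complex.I) / 2) ^ (n + 1)) ∧
    (∀ n : ℕ, ∀ k ≤ n,
      (1 / Real.pi) *
          ∫ x : ℝ, x ^ k * (Ppoly (fun _ => 0) (fun _ => 1 / 4) n).eval x /
            (x ^ 2 + 1) ^ (n + 1) =
        if n = k then (1 : ℝ) / 2 ^ n else 0) := by
  refine ⟨aeval_Ppoly_zero_quarter, fun n k hk => ?_⟩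
  simp_rw [mul_div_assoc, eval_Ppoly_zero_quarter_div, mul_left_comm _ ((1 : ℝ) / 2 ^ n)]
  rw [integral_const_mul, integral_pow_mul_imInvPow hk]
  split_ifs
  · field_simp
  · simp
end
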